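/- arXiv:1912.01238 — 2 statements merged into one kernel-verified Lean document; each statement's English description precedes it below -/
import Mathlib

section
/- Let E be a real normed vector space, X and Y nonempty finite types, and F : E → X → Y → ℝ. Define Z(θ) = ∑_{x' ∈ X, y' ∈ Y} exp(F θ x' y'), the joint density p_θ(x,y) = exp(F θ x y) / Z(θ), the marginal p_θ(x) = ∑_{y ∈ Y} p_θ(x,y), and the conditional p_θ(y | x) = exp(F θ x y) / ∑_{y' ∈ Y} exp(F θ x y'). Fix θ₀ ∈ E and assume that for every (x', y') ∈ X × Y the map θ ↦ F θ x' y' is differentiable at θ₀. Then for every x ∈ X the map θ ↦ log p_θ(x) is differentiable at θ₀ with Fréchet derivative ∑_{y ∈ Y} p_{θ₀}(y | x) · D_θ F(·, x, y)|_{θ₀} − ∑_{x' ∈ X, y' ∈ Y} p_{θ₀}(x', y') · D_θ F(·, x', y')|_{θ₀}, i.e., ∇_θ log p_θ(x) = E_{p_θ(y|x)}[ y^⊤∇_θ f_θ(x) ] − E_{p_θ(x,y)}[ y^⊤∇_θ f_θ(x) ]. -/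
/-- The derivative of log-sum-exp is the softmax-weighted average of the derivatives. -/
theorem HasFDerivAt.log_sum_exp {E ι : Type*} [NormedAddCommGroup E] [NormedSpace ℝ E]
    [Fintype ι] [Nonempty ι] {g : E → ι → ℝ} {g' : ι → E →L[ℝ] ℝ} {θ₀ : E}
    (hg : ∀ i, HasFDerivAt (fun θ => g θ i) (g' i) θ₀) :
    HasFDerivAt (fun θ => Real.log (∑ i, Real.exp (g θ i)))
      (∑ i, (Real.exp (g θ₀ i) / ∑ j, Real.exp (g θ₀ j)) • g' i) θ₀ := by
  have hpos : 0 < ∑ i, Real.exp (g θ₀ i) :=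
    Finset.sum_pos (fun i _ => Real.exp_pos _) Finset.univ_nonempty
  have hsum : HasFDerivAt (fun θ => ∑ i, Real.exp (g θ i))
      (∑ i, Real.exp (g θ₀ i) • g' i) θ₀ :=
    HasFDerivAt.fun_sum fun i _ => (hg i).exp
  convert hsum.log hpos.ne' using 1
  simp only [Finset.smul_sum, smul_smul, div_eq_inv_mul]

/-- Theorem 1 of the paper: the gradient of the log marginal `log p_θ(x)` of the joint
EBM at `θ₀` equals `E_{p_{θ₀}(y|x)}[∇_θ F θ x y] − E_{p_{θ₀}(x',y')}[∇_θ F θ x' y']`. -/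
theorem hasFDerivAt_log_marginal_ebm
    {E : Type*} [NormedAddCommGroup E] [NormedSpace ℝ E]
    {X Y : Type*} [Fintype X] [Fintype Y] [Nonempty X] [Nonempty Y]
    (F : E → X → Y → ℝ)
    (Z : E → ℝ) (hZ : ∀ θ, Z θ = ∑ x' : X, ∑ y' : Y, Real.exp (F θ x' y'))
    (p : E → X → Y → ℝ) (hp : ∀ θ x y, p θ x y = Real.exp (F θ x y) / Z θ)
    (pX : E → X → ℝ) (hpX : ∀ θ x, pX θ x = ∑ y : Y, p θ x y)
    (pcond : E → X → Y → ℝ)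
    (hpcond : ∀ θ x y,
      pcond θ x y = Real.exp (F θ x y) / ∑ y' : Y, Real.exp (F θ x y'))
    (θ₀ : E) (F' : X → Y → E →L[ℝ] ℝ)
    (hF : ∀ x' y', HasFDerivAt (fun θ => F θ x' y') (F' x' y') θ₀) :
    ∀ x : X,
      HasFDerivAt (fun θ => Real.log (pX θ x))
        ((∑ y : Y, pcond θ₀ x y • F' x y)
          - ∑ x' : X, ∑ y' : Y, p θ₀ x' y' • F' x' y') θ₀ := by
  intro x
  have hlog : (fun θ => Real.log (pX θ x)) = fun θ =>
      Real.log (∑ y, Real.exp (F θ x y)) -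
        Real.log (∑ i : X × Y, Real.exp (F θ i.1 i.2)) := by
    funext θ
    have hx : 0 < ∑ y, Real.exp (F θ x y) :=
      Finset.sum_pos (fun _ _ => Real.exp_pos _) Finset.univ_nonempty
    have hxy : 0 < ∑ i : X × Y, Real.exp (F θ i.1 i.2) :=
      Finset.sum_pos (fun _ _ => Real.exp_pos _) Finset.univ_nonempty
    rw [← Real.log_div hx.ne' hxy.ne', hpX, Finset.sum_div, Fintype.sum_prod_type]
    simp only [hp, hZ]
  have h := (HasFDerivAt.log_sum_exp (hF x)).fun_sub
    (HasFDerivAt.log_sum_exp fun i : X × Y => hF i.1 i.2)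
  rw [hlog]
  simpa only [hpcond, hp, hZ, Fintype.sum_prod_type] using h
end

section
/- Let E be a real normed vector space, X and Y nonempty finite types, and F : E → X → Y → ℝ. Define Z(θ) = ∑_{x' ∈ X, y' ∈ Y} exp(F θ x' y'), the joint density p_θ(x,y) = exp(F θ x y) / Z(θ), the marginal p_θ(x) = ∑_{y} p_θ(x,y), and the conditional p_θ(y | x) = exp(F θ x y) / ∑_{y'} exp(F θ x y'). Fix θ₀ ∈ E and assume that for every (x', y') ∈ X × Y the map θ ↦ F θ x' y' is differentiable at θ₀. Then for every λ ∈ ℝ and every (x, y) ∈ X × Y, the per-sample training objective θ ↦ −(1 − λ) · log p_θ(x,y) − λ · log p_θ(y | x) − λ · log p_θ(x) is differentiable at θ₀ with Fréchet derivative ∑_{x' ∈ X, y' ∈ Y} p_{θ₀}(x', y') · D_θ F(·, x', y')|_{θ₀} − D_θ F(·, x, y)|_{θ₀}, i.e., the gradient of the combined discriminative-plus-generative loss equals E_{p_θ(x',y')}[ y'^⊤∇_θ f_θ(x') ] − y^⊤∇_θ f_θ(x), independently of λ. -/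
/-- Core gradient computation of Theorem 3 of the paper: for every `λ`, the per-sample
objective `−(1−λ)·log p_θ(x,y) − λ·log p_θ(y|x) − λ·log p_θ(x)` is differentiable at
`θ₀` with gradient `E_{p_{θ₀}(x',y')}[∇_θ F θ x' y'] − ∇_θ F θ x y`, independently of
`λ`. -/
theorem hasFDerivAt_combined_generative_discriminative_loss
    {E : Type*} [NormedAddCommGroup E] [NormedSpace ℝ E]
    {X Y : Type*} [Fintype X] [Fintype Y] [Nonempty X] [Nonempty Y]
    (F : E → X → Y → ℝ)
    (Z : E → ℝ) (hZ : ∀ θ, Z θ = ∑ x' : X, ∑ y' : Y, Real.exp (F θ x' y'))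
    (p : E → X → Y → ℝ) (hp : ∀ θ x y, p θ x y = Real.exp (F θ x y) / Z θ)
    (pX : E → X → ℝ) (hpX : ∀ θ x, pX θ x = ∑ y : Y, p θ x y)
    (pcond : E → X → Y → ℝ)
    (hpcond : ∀ θ x y,
      pcond θ x y = Real.exp (F θ x y) / ∑ y' : Y, Real.exp (F θ x y'))
    (θ₀ : E) (F' : X → Y → E →L[ℝ] ℝ)
    (hF : ∀ x' y', HasFDerivAt (fun θ => F θ x' y') (F' x' y') θ₀) :
    ∀ (lam : ℝ) (x : X) (y : Y),
      HasFDerivAt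
        (fun θ => -(1 - lam) * Real.log (p θ x y)
          - lam * Real.log (pcond θ x y) - lam * Real.log (pX θ x))
        ((∑ x' : X, ∑ y' : Y, p θ₀ x' y' • F' x' y') - F' x y) θ₀ := by
  intro lam x y
  have hZ_pos (θ : E) : 0 < Z θ := by
    rw [hZ]
    positivity
  have hS_pos (θ : E) : 0 < ∑ y' : Y, Real.exp (F θ x y') := by positivity
  have h_obj : (fun θ => -(1 - lam) * Real.log (p θ x y)
      - lam * Real.log (pcond θ x y) - lam * Real.log (pX θ x))
      = fun θ => Real.log (Z θ) - F θ x y := by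
    funext θ
    have h_marginal : pX θ x = (∑ y' : Y, Real.exp (F θ x y')) / Z θ := by
      simp only [hpX, hp, Finset.sum_div]
    rw [h_marginal, hp, hpcond, Real.log_div (Real.exp_ne_zero _) (hZ_pos θ).ne',
      Real.log_div (Real.exp_ne_zero _) (hS_pos θ).ne',
      Real.log_div (hS_pos θ).ne' (hZ_pos θ).ne', Real.log_exp]
    ring
  have hZ_deriv : HasFDerivAt Z
      (∑ x' : X, ∑ y' : Y, Real.exp (F θ₀ x' y') • F' x' y') θ₀ := by
    rw [funext hZ]
    exact HasFDerivAt.fun_sum fun x' _ => HasFDerivAt.fun_sum fun y' _ => (hF x' y').exp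
  have h_grad : ∑ x' : X, ∑ y' : Y, p θ₀ x' y' • F' x' y'
      = (Z θ₀)⁻¹ • ∑ x' : X, ∑ y' : Y, Real.exp (F θ₀ x' y') • F' x' y' := by
    simp only [Finset.smul_sum, smul_smul, hp, div_eq_inv_mul]
  rw [h_obj, h_grad]
  exact (hZ_deriv.log (hZ_pos θ₀).ne').sub (hF x y)
end
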